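/- arXiv:math-ph/0109018 — 3 statements merged into one kernel-verified Lean document; each statement's English description precedes it below -/
import Mathlib

section
/- (First deformation matrix.) For every u ∈ U, every n ≥ 1 and every x ∈ ℝ: ∂ψ_{n−1}/∂u_1 (u, x) = −(1/2)[ (β_{n−1}(u) − x) ψ_{n−1}(u, x) + 2 γ_n(u) ψ_n(u, x) ] and ∂ψ_n/∂u_1 (u, x) = −(1/2)[ −2 γ_n(u) ψ_{n−1}(u, x) + (x − β_n(u)) ψ_n(u, x) ]. -/
open MeasureTheory Polynomial Real

/-- `P'` is the coefficientwise derivative at `t₀` of the polynomial path `P`. -/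
def HasCoeffDerivAt (P : ℝ → ℝ[X]) (P' : ℝ[X]) (t₀ : ℝ) : Prop :=
  ∀ j, HasDerivAt (fun t => (P t).coeff j) (P'.coeff j) t₀

theorem HasCoeffDerivAt.mul {P Q : ℝ → ℝ[X]} {P' Q' : ℝ[X]} {t₀ : ℝ}
    (hP : HasCoeffDerivAt P P' t₀) (hQ : HasCoeffDerivAt Q Q' t₀) :
    HasCoeffDerivAt (fun t => P t * Q t) (P' * Q t₀ + P t₀ * Q') t₀ := by
  intro j
  simp only [coeff_add, coeff_mul, ← Finset.sum_add_distrib]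
  exact HasDerivAt.fun_sum fun i _ => (hP i.1).mul (hQ i.2)

theorem HasCoeffDerivAt.natDegree_le {P : ℝ → ℝ[X]} {P' : ℝ[X]} {t₀ : ℝ} {N : ℕ}
    (hP : HasCoeffDerivAt P P' t₀) (hN : ∀ᶠ t in nhds t₀, (P t).natDegree ≤ N) :
    P'.natDegree ≤ N := by
  refine natDegree_le_iff_coeff_eq_zero.2 fun j hj => ?_
  refine (hP j).unique ((hasDerivAt_const t₀ (0 : ℝ)).congr_of_eventuallyEq ?_)
  filter_upwards [hN] with t ht
  exact coeff_eq_zero_of_natDegree_lt (ht.trans_lt hj)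

theorem HasCoeffDerivAt.eval {P : ℝ → ℝ[X]} {P' : ℝ[X]} {t₀ : ℝ} {N : ℕ}
    (hP : HasCoeffDerivAt P P' t₀) (hN : ∀ᶠ t in nhds t₀, (P t).natDegree ≤ N) (x : ℝ) :
    HasDerivAt (fun t => (P t).eval x) (P'.eval x) t₀ := by
  rw [eval_eq_sum_range' (Nat.lt_succ_of_le (hP.natDegree_le hN)) x]
  refine (HasDerivAt.fun_sum (u := Finset.range N.succ)
    fun j _ => (hP j).mul_const (x ^ j)).congr_of_eventuallyEq ?_
  filter_upwards [hN] with t ht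
  exact eval_eq_sum_range' (Nat.lt_succ_of_le ht) x

/-- A path of monic polynomials of degree `n` with differentiable coefficients has a coefficientwise
derivative of degree less than `n`. -/
theorem exists_hasCoeffDerivAt_of_monic {P : ℝ → ℝ[X]} {t₀ : ℝ} {n : ℕ}
    (hmonic : ∀ᶠ t in nhds t₀, (P t).Monic) (hdeg : ∀ᶠ t in nhds t₀, (P t).natDegree = n)
    (hdiff : ∀ j, DifferentiableAt ℝ (fun t => (P t).coeff j) t₀) :
    ∃ P' : ℝ[X], P'.degree < n ∧ HasCoeffDerivAt P P' t₀ := by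
  have hcoeff : ∀ i, (∑ j ∈ Finset.range n,
      monomial j (deriv (fun t => (P t).coeff j) t₀)).coeff i =
        if i < n then deriv (fun t => (P t).coeff i) t₀ else 0 := by
    intro i
    simp [finsetSum_coeff, coeff_monomial]
  refine ⟨∑ j ∈ Finset.range n, monomial j (deriv (fun t => (P t).coeff j) t₀),
    (degree_lt_iff_coeff_zero _ _).2 fun i hi => ?_, fun i => ?_⟩
  · rw [hcoeff, if_neg hi.not_gt]
  · rw [hcoeff]
    split_ifs with hi
    · exact (hdiff i).hasDerivAt
    · refine (hasDerivAt_const t₀ (if i = n then (1 : ℝ) else 0)).congr_of_eventuallyEq ?_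
      filter_upwards [hmonic, hdeg] with t hm hd
      split_ifs with hin
      · rw [hin, ← hd]
        exact hm
      · exact coeff_eq_zero_of_natDegree_lt (by omega)

/-- Integration of polynomials against a weight with finite moments, as a linear functional. -/
noncomputable def polyIntegral (w : ℝ → ℝ)
    (hw : ∀ q : ℝ[X], Integrable fun x => q.eval x * w x) : ℝ[X] →ₗ[ℝ] ℝ where
  toFun q := ∫ x, q.eval x * w x
  map_add' q r := by
    simp only [eval_add, add_mul]
    exact integral_add (hw q) (hw r)
  map_smul' c q := by
    simp only [eval_smul, smul_eq_mul, mul_assoc, integral_const_mul, RingHom.id_apply]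

theorem hasDerivAt_integral_exp_tilt {v : ℝ → ℝ} {t₀ : ℝ}
    (hint : ∀ᶠ t in nhds t₀, ∀ q : ℝ[X],
      Integrable fun x => q.eval x * Real.exp (-(v x + t * x))) (q : ℝ[X]) :
    HasDerivAt (fun t => ∫ x, q.eval x * Real.exp (-(v x + t * x)))
      (-∫ x, (X * q).eval x * Real.exp (-(v x + t₀ * x))) t₀ := by
  obtain ⟨ε, hε, hball⟩ := Metric.eventually_nhds_iff_ball.1 hint
  have hp := hball (t₀ + ε / 2) (by
    rw [Metric.mem_ball, Real.dist_eq, add_sub_cancel_left, abs_of_pos (by positivity)]; linarith)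
  have hm := hball (t₀ - ε / 2) (by
    rw [Metric.mem_ball, Real.dist_eq, abs_sub_comm, sub_sub_cancel, abs_of_pos (by positivity)]
    linarith)
  rw [← integral_neg]
  refine (hasDerivAt_integral_of_dominated_loc_of_deriv_le
    (F := fun t x => q.eval x * Real.exp (-(v x + t * x)))
    (F' := fun t x => -((X * q).eval x * Real.exp (-(v x + t * x))))
    (bound := fun x => ‖(X * q).eval x * Real.exp (-(v x + (t₀ + ε / 2) * x))‖ +
      ‖(X * q).eval x * Real.exp (-(v x + (t₀ - ε / 2) * x))‖)
    (Metric.ball_mem_nhds t₀ (half_pos hε)) ?_ ?_ ?_ ?_ ?_ ?_).2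
  · filter_upwards [hint] with t ht using (ht q).aestronglyMeasurable
  · exact hint.self_of_nhds q
  · exact (hint.self_of_nhds (X * q)).neg.aestronglyMeasurable
  · refine Filter.Eventually.of_forall fun x t ht => ?_
    rw [Metric.mem_ball, Real.dist_eq, abs_lt] at ht
    simp only [norm_neg, norm_mul, Real.norm_eq_abs, Real.abs_exp, ← mul_add]
    refine mul_le_mul_of_nonneg_left ?_ (abs_nonneg _)
    rcases le_total 0 x with hx | hx
    · refine le_add_of_nonneg_of_le (Real.exp_pos _).le (Real.exp_le_exp.2 ?_)
      nlinarith
    · refine le_add_of_le_of_nonneg (Real.exp_le_exp.2 ?_) (Real.exp_pos _).le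
      nlinarith
  · exact (hp (X * q)).norm.add (hm (X * q)).norm
  · refine Filter.Eventually.of_forall fun x t _ => ?_
    have hlin : HasDerivAt (fun s : ℝ => -(v x + s * x)) (-x) t := by
      simpa using (((hasDerivAt_id t).mul_const x).const_add (v x)).fun_neg
    refine (hlin.exp.const_mul (q.eval x)).congr_deriv ?_
    rw [eval_mul, eval_X]
    ring

theorem HasCoeffDerivAt.integral_exp_tilt {v : ℝ → ℝ} {t₀ : ℝ}
    (hint : ∀ᶠ t in nhds t₀, ∀ q : ℝ[X],
      Integrable fun x => q.eval x * Real.exp (-(v x + t * x)))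
    {P : ℝ → ℝ[X]} {P' : ℝ[X]} {N : ℕ}
    (hP : HasCoeffDerivAt P P' t₀) (hN : ∀ᶠ t in nhds t₀, (P t).natDegree ≤ N) :
    HasDerivAt (fun t => ∫ x, (P t).eval x * Real.exp (-(v x + t * x)))
      (polyIntegral _ hint.self_of_nhds P' - polyIntegral _ hint.self_of_nhds (X * P t₀)) t₀ := by
  have hsum : ∀ {t : ℝ} (ht : ∀ q : ℝ[X],
      Integrable fun x => q.eval x * Real.exp (-(v x + t * x))) (q r : ℝ[X]),
      q.natDegree ≤ N → polyIntegral _ ht (r * q) =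
        ∑ j ∈ Finset.range (N + 1), q.coeff j * polyIntegral _ ht (r * X ^ j) := by
    intro t ht q r hq
    conv_lhs => rw [q.as_sum_range_C_mul_X_pow' (Nat.lt_succ_of_le hq)]
    simp only [Finset.mul_sum, map_sum, ← smul_eq_C_mul, mul_smul_comm, map_smul, smul_eq_mul]
  have hmom : ∀ j : ℕ, HasDerivAt
      (fun t => (P t).coeff j * ∫ x, (X ^ j : ℝ[X]).eval x * Real.exp (-(v x + t * x)))
      (P'.coeff j * polyIntegral _ hint.self_of_nhds (1 * X ^ j) -
        (P t₀).coeff j * polyIntegral _ hint.self_of_nhds (X * X ^ j)) t₀ := fun j => by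
    refine ((hP j).mul (hasDerivAt_integral_exp_tilt hint (X ^ j))).congr_deriv ?_
    rw [one_mul, mul_neg, ← sub_eq_add_neg]
    rfl
  rw [← one_mul P', hsum _ P' 1 (hP.natDegree_le hN), hsum _ _ X hN.self_of_nhds,
    ← Finset.sum_sub_distrib]
  refine (HasDerivAt.fun_sum fun j _ => hmom j).congr_of_eventuallyEq ?_
  filter_upwards [hN, hint] with t ht hti
  have := hsum hti (P t) 1 ht
  simp only [one_mul] at this
  exact this

section MonicOrthogonal

variable {L : ℝ[X] →ₗ[ℝ] ℝ} {p : ℕ → ℝ[X]}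

theorem map_mul_eq_zero_of_degree_lt (hmonic : ∀ n, (p n).Monic) (hdeg : ∀ n, (p n).natDegree = n)
    (horth : ∀ n m, n ≠ m → L (p n * p m) = 0) {m : ℕ} :
    ∀ {q : ℝ[X]}, q.degree < m → L (q * p m) = 0 := by
  have key : ∀ d ≤ m, ∀ q : ℝ[X], q.degree < d → L (q * p m) = 0 := by
    intro d
    induction d with
    | zero =>
      intro _ q hq
      have : q = 0 := by
        refine Polynomial.ext fun i => ?_
        simpa using (degree_lt_iff_coeff_zero q 0).1 (by simpa using hq) i (Nat.zero_le i)
      simp [this]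
    | succ d ih =>
      intro hd q hq
      have hr : (q - q.coeff d • p d).degree < d := by
        rw [degree_lt_iff_coeff_zero] at hq ⊢
        intro i hi
        rcases hi.eq_or_lt with rfl | hi
        · have : (p d).coeff d = 1 := by simpa [hdeg] using (hmonic d).coeff_natDegree
          simp [this]
        · have : (p d).coeff i = 0 := coeff_eq_zero_of_natDegree_lt (by rwa [hdeg])
          simp [this, hq i hi]
      have := ih (by omega) _ hr
      rwa [sub_mul, smul_mul_assoc, map_sub, map_smul, horth d m (by omega), smul_zero,
        sub_zero] at this
  exact fun {q} hq => key m le_rfl q hq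

theorem degree_sub_lt_of_monic {q r : ℝ[X]} {n : ℕ} (hq : q.Monic) (hr : r.Monic)
    (hqn : q.natDegree = n) (hrn : r.natDegree = n) : (q - r).degree < n := by
  rw [degree_lt_iff_coeff_zero]
  intro i hi
  rcases hi.eq_or_lt with rfl | hi
  · have h₁ := hq.coeff_natDegree
    have h₂ := hr.coeff_natDegree
    rw [hqn] at h₁
    rw [hrn] at h₂
    simp [h₁, h₂]
  · simp [coeff_eq_zero_of_natDegree_lt (hqn.trans_lt hi),
      coeff_eq_zero_of_natDegree_lt (hrn.trans_lt hi)]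

theorem map_mul_self_of_monic (hmonic : ∀ n, (p n).Monic) (hdeg : ∀ n, (p n).natDegree = n)
    (horth : ∀ n m, n ≠ m → L (p n * p m) = 0) {q : ℝ[X]} {m : ℕ} (hq : q.Monic)
    (hqm : q.natDegree = m) : L (q * p m) = L (p m * p m) := by
  have := map_mul_eq_zero_of_degree_lt hmonic hdeg horth
    (degree_sub_lt_of_monic hq (hmonic m) hqm (hdeg m))
  rwa [sub_mul, map_sub, sub_eq_zero] at this

theorem eq_zero_of_forall_map_mul_eq_zero (hmonic : ∀ n, (p n).Monic)
    (hdeg : ∀ n, (p n).natDegree = n) (horth : ∀ n m, n ≠ m → L (p n * p m) = 0)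
    (hpos : ∀ n, L (p n * p n) ≠ 0) {q : ℝ[X]} {n : ℕ} (hq : q.degree < n)
    (hqp : ∀ k < n, L (q * p k) = 0) : q = 0 := by
  by_contra hq0
  have hlc : q.leadingCoeff ≠ 0 := leadingCoeff_ne_zero.2 hq0
  have hlt : q.natDegree < n := (natDegree_lt_iff_degree_lt hq0).2 hq
  have h₁ := map_mul_self_of_monic hmonic hdeg horth (q := C q.leadingCoeff⁻¹ * q)
    (m := q.natDegree) (by rw [mul_comm]; exact monic_mul_leadingCoeff_inv hq0)
    (natDegree_C_mul (inv_ne_zero hlc))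
  rw [← smul_eq_C_mul, smul_mul_assoc, map_smul, hqp _ hlt, smul_zero] at h₁
  exact hpos _ h₁.symm

theorem eq_smul_pred_of_map_mul_eq (hmonic : ∀ n, (p n).Monic)
    (hdeg : ∀ n, (p n).natDegree = n) (horth : ∀ n m, n ≠ m → L (p n * p m) = 0)
    (hpos : ∀ n, L (p n * p n) ≠ 0) {q : ℝ[X]} {n : ℕ} (hq : q.degree < (n + 1 : ℕ))
    (hqp : ∀ k < n + 1, L (q * p k) = L (X * (p (n + 1) * p k))) :
    q = (L (p (n + 1) * p (n + 1)) / L (p n * p n)) • p n := by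
  refine sub_eq_zero.1 (eq_zero_of_forall_map_mul_eq_zero hmonic hdeg horth hpos (n := n + 1)
    ?_ fun k hk => ?_)
  · refine (degree_sub_le _ _).trans_lt (max_lt hq ((degree_smul_le _ _).trans_lt ?_))
    rw [degree_eq_natDegree (hmonic n).ne_zero, hdeg]
    exact_mod_cast n.lt_succ_self
  · have hX : L (X * (p (n + 1) * p k)) = L (X * p k * p (n + 1)) := by ring_nf
    have hXd : (X * p k).natDegree = k + 1 := by
      rw [natDegree_X_mul (hmonic k).ne_zero, hdeg]
    have hXm : (X * p k).Monic := monic_X.mul (hmonic k)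
    rw [sub_mul, smul_mul_assoc, map_sub, map_smul, hqp k hk, hX, smul_eq_mul]
    rcases Nat.lt_succ_iff_lt_or_eq.1 hk with hlt | rfl
    · rw [horth n k (by omega), map_mul_eq_zero_of_degree_lt hmonic hdeg horth, mul_zero, sub_zero]
      rw [degree_eq_natDegree hXm.ne_zero, hXd]
      exact_mod_cast Nat.succ_lt_succ hlt
    · rw [map_mul_self_of_monic hmonic hdeg horth hXm hXd, div_mul_cancel₀ _ (hpos k), sub_self]

theorem eq_X_sub_C_mul_sub_succ_of_map_mul_eq (hmonic : ∀ n, (p n).Monic)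
    (hdeg : ∀ n, (p n).natDegree = n) (horth : ∀ n m, n ≠ m → L (p n * p m) = 0)
    (hpos : ∀ n, L (p n * p n) ≠ 0) {q : ℝ[X]} {n : ℕ} (hq : q.degree < n)
    (hqp : ∀ k < n, L (q * p k) = L (X * (p n * p k))) :
    q = X * p n - (L (X * (p n * p n)) / L (p n * p n)) • p n - p (n + 1) := by
  have hlt : (n : WithBot ℕ) < (n + 1 : ℕ) := by exact_mod_cast n.lt_succ_self
  refine sub_eq_zero.1 (eq_zero_of_forall_map_mul_eq_zero hmonic hdeg horth hpos (n := n + 1)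
    ?_ fun k hk => ?_)
  · rw [sub_right_comm (X * p n)]
    refine (degree_sub_le _ _).trans_lt (max_lt (hq.trans hlt)
      ((degree_sub_le _ _).trans_lt (max_lt ?_ ((degree_smul_le _ _).trans_lt ?_))))
    · exact degree_sub_lt_of_monic (monic_X.mul (hmonic n)) (hmonic _)
        (by rw [natDegree_X_mul (hmonic n).ne_zero, hdeg]) (hdeg _)
    · rwa [degree_eq_natDegree (hmonic n).ne_zero, hdeg]
  · rw [sub_mul, sub_mul, sub_mul, smul_mul_assoc, map_sub, map_sub, map_sub, map_smul,
      horth (n + 1) k (by omega), mul_assoc, smul_eq_mul]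
    rcases Nat.lt_succ_iff_lt_or_eq.1 hk with hlt | rfl
    · rw [hqp k hlt, horth n k hlt.ne']
      ring
    · rw [map_mul_eq_zero_of_degree_lt hmonic hdeg horth hq, div_mul_cancel₀ _ (hpos k)]
      ring

end MonicOrthogonal

/-- For monic orthogonal polynomials `p t n` of the weight `exp (-(v x + t * x))` with
differentiable coefficients, the coefficientwise derivative `q` of `t ↦ p t n` satisfies
`⟨q, p k⟩ = ⟨X p n, p k⟩` for `k < n`, and the squared norm has derivative `-⟨X p n, p n⟩`. -/
theorem exists_hasCoeffDerivAt_orthogonal {v : ℝ → ℝ} {t₀ : ℝ}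
    (hint : ∀ᶠ t in nhds t₀, ∀ q : ℝ[X],
      Integrable fun x => q.eval x * Real.exp (-(v x + t * x)))
    {p : ℝ → ℕ → ℝ[X]} (hmonic : ∀ᶠ t in nhds t₀, ∀ n, (p t n).Monic)
    (hdeg : ∀ᶠ t in nhds t₀, ∀ n, (p t n).natDegree = n)
    (horth : ∀ᶠ t in nhds t₀, ∀ n m, n ≠ m →
      ∫ x, (p t n * p t m).eval x * Real.exp (-(v x + t * x)) = 0)
    (hdiff : ∀ n j, DifferentiableAt ℝ (fun t => (p t n).coeff j) t₀) (n : ℕ) :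
    ∃ q : ℝ[X], q.degree < n ∧ HasCoeffDerivAt (fun t => p t n) q t₀ ∧
      (∀ k < n, polyIntegral _ hint.self_of_nhds (q * p t₀ k) =
        polyIntegral _ hint.self_of_nhds (X * (p t₀ n * p t₀ k))) ∧
      HasDerivAt (fun t => ∫ x, (p t n * p t n).eval x * Real.exp (-(v x + t * x)))
        (-polyIntegral _ hint.self_of_nhds (X * (p t₀ n * p t₀ n))) t₀ := by
  have hex : ∀ k : ℕ, ∃ q : ℝ[X], q.degree < k ∧ HasCoeffDerivAt (fun t => p t k) q t₀ := fun k =>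
    exists_hasCoeffDerivAt_of_monic (hmonic.mono fun _ h => h k) (hdeg.mono fun _ h => h k)
      (hdiff k)
  choose q hqdeg hq using hex
  have hperp {m : ℕ} {r : ℝ[X]} (hr : r.degree < m) :
      polyIntegral _ hint.self_of_nhds (r * p t₀ m) = 0 :=
    map_mul_eq_zero_of_degree_lt hmonic.self_of_nhds hdeg.self_of_nhds
      (fun i j hij => horth.self_of_nhds i j hij) hr
  have hpair (k : ℕ) := ((hq n).mul (hq k)).integral_exp_tilt hint (N := n + k) (by
    filter_upwards [hdeg] with t ht
    exact natDegree_mul_le_of_le (ht n).le (ht k).le)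
  refine ⟨q n, hqdeg n, hq n, fun k hk => ?_, ?_⟩
  · have hzero := (hpair k).unique ((hasDerivAt_const t₀ (0 : ℝ)).congr_of_eventuallyEq
      (horth.mono fun t ht => ht n k hk.ne'))
    have hqk : (q k).degree < n := (hqdeg k).trans (by exact_mod_cast hk)
    rw [map_add, mul_comm (p t₀ n) (q k), hperp hqk, add_zero] at hzero
    exact sub_eq_zero.1 hzero
  · refine (hpair n).congr_deriv ?_
    rw [map_add, mul_comm (p t₀ n) (q n), hperp (hqdeg n)]
    ring

theorem stmt16
    (D : ℕ) (hDeven : Even D) (hD2 : 2 ≤ D)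
    (U : Set (Fin D → ℝ)) (hUopen : IsOpen U)
    (hUpos : ∀ u ∈ U, 0 < u ⟨D - 1, by omega⟩)
    (Vf : (Fin D → ℝ) → ℝ → ℝ)
    (hVf : ∀ (u : Fin D → ℝ) (x : ℝ),
      Vf u x = ∑ i : Fin D, u i / ((i : ℕ) + 1) * x ^ ((i : ℕ) + 1))
    (hint : ∀ u ∈ U, ∀ q : Polynomial ℝ,
      Integrable (fun x : ℝ => q.eval x * Real.exp (-(Vf u x))))
    (p : (Fin D → ℝ) → ℕ → Polynomial ℝ)
    (hmonic : ∀ u ∈ U, ∀ n, (p u n).Monic)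
    (hpdeg : ∀ u ∈ U, ∀ n, (p u n).natDegree = n)
    (horth : ∀ u ∈ U, ∀ n m, n ≠ m →
      ∫ x : ℝ, (p u n).eval x * (p u m).eval x * Real.exp (-(Vf u x)) = 0)
    (h : (Fin D → ℝ) → ℕ → ℝ)
    (hh : ∀ (u : Fin D → ℝ) (n : ℕ),
      h u n = ∫ x : ℝ, ((p u n).eval x) ^ 2 * Real.exp (-(Vf u x)))
    (hhpos : ∀ u ∈ U, ∀ n, 0 < h u n)
    (ψ : (Fin D → ℝ) → ℕ → ℝ → ℝ)
    (hψ : ∀ (u : Fin D → ℝ) (n : ℕ) (x : ℝ),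
      ψ u n x = (p u n).eval x * Real.exp (-(Vf u x) / 2) / Real.sqrt (h u n))
    (hcoeff : ∀ n j, DifferentiableOn ℝ (fun u => (p u n).coeff j) U)
    (γ : (Fin D → ℝ) → ℕ → ℝ)
    (hγ : ∀ (u : Fin D → ℝ) (n : ℕ), 1 ≤ n → γ u n = Real.sqrt (h u n / h u (n - 1)))
    (β : (Fin D → ℝ) → ℕ → ℝ)
    (hβ : ∀ (u : Fin D → ℝ) (n : ℕ), β u n = ∫ x : ℝ, x * (ψ u n x) ^ 2)
    (u : Fin D → ℝ) (hu : u ∈ U) (n : ℕ) (hn : 1 ≤ n) (x : ℝ) :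
    HasDerivAt (fun t => ψ (Function.update u ⟨0, by omega⟩ t) (n - 1) x)
      (-(1 / 2) * ((β u (n - 1) - x) * ψ u (n - 1) x + 2 * γ u n * ψ u n x))
      (u ⟨0, by omega⟩) ∧
    HasDerivAt (fun t => ψ (Function.update u ⟨0, by omega⟩ t) n x)
      (-(1 / 2) * (-(2 * γ u n) * ψ u (n - 1) x + (x - β u n) * ψ u n x))
      (u ⟨0, by omega⟩) := by
  set i₀ : Fin D := ⟨0, by omega⟩ with hi₀
  set t₀ := u i₀ with ht₀
  set v : ℝ → ℝ := fun y => Vf u y - t₀ * y with hv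
  have hupd : Function.update u i₀ t₀ = u := Function.update_eq_self i₀ u
  have hVt (t y : ℝ) : Vf (Function.update u i₀ t) y = v y + t * y := by
    have hsub : Vf (Function.update u i₀ t) y - Vf u y = (t - t₀) * y := by
      rw [hVf, hVf, ← Finset.sum_sub_distrib, Finset.sum_eq_single i₀]
      · simp [hi₀, ht₀, sub_mul]
      · intro i _ hi
        rw [Function.update_of_ne hi, sub_self]
      · simp
    simp only [hv]
    linarith
  have hVu (y : ℝ) : Vf u y = v y + t₀ * y := by simp [hv]
  have hmem : ∀ᶠ t in nhds t₀, Function.update u i₀ t ∈ U := by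
    refine (continuous_const.update i₀ continuous_id).continuousAt.eventually
      (hUopen.mem_nhds ?_)
    simpa [hupd] using hu
  have hintt : ∀ᶠ t in nhds t₀, ∀ q : ℝ[X],
      Integrable fun y => q.eval y * Real.exp (-(v y + t * y)) :=
    hmem.mono fun t ht q => by simpa only [hVt] using hint _ ht q
  set L := polyIntegral _ hintt.self_of_nhds with hL
  have hLapp (q : ℝ[X]) : L q = ∫ y, q.eval y * Real.exp (-(Vf u y)) := by
    simp only [hVu]
    rfl
  have hLh (k : ℕ) : L (p u k * p u k) = h u k := by
    simp only [hLapp, hh, eval_mul, pow_two]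
  have horthL : ∀ k m, k ≠ m → L (p u k * p u m) = 0 := fun k m hkm => by
    simpa only [hLapp, eval_mul] using horth u hu k m hkm
  have hLne (k : ℕ) : L (p u k * p u k) ≠ 0 := by
    rw [hLh]
    exact (hhpos u hu k).ne'
  have hdiff (k j : ℕ) :
      DifferentiableAt ℝ (fun t => (p (Function.update u i₀ t) k).coeff j) t₀ := by
    have hout : DifferentiableAt ℝ (fun w => (p w k).coeff j) (Function.update u i₀ t₀) := by
      rw [hupd]
      exact (hcoeff k j).differentiableAt (hUopen.mem_nhds hu)
    exact hout.comp t₀ (hasDerivAt_update u i₀ t₀).differentiableAt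
  have hpath := exists_hasCoeffDerivAt_orthogonal hintt (p := fun t => p (Function.update u i₀ t))
    (hmem.mono fun t ht => hmonic _ ht) (hmem.mono fun t ht => hpdeg _ ht)
    (hmem.mono fun t ht k m hkm => by
      simpa only [hVt, eval_mul] using horth _ ht k m hkm) hdiff
  simp only [hupd] at hpath
  choose q hqdeg hq hqL hqh using hpath
  have hβL (k : ℕ) : β u k = L (X * (p u k * p u k)) / L (p u k * p u k) := by
    rw [hβ, hLh, hLapp, ← integral_div]
    refine integral_congr_ae (Filter.Eventually.of_forall fun y => ?_)
    have hexp : Real.exp (-(Vf u y) / 2) ^ 2 = Real.exp (-(Vf u y)) := by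
      rw [pow_two, ← Real.exp_add, add_halves]
    simp only [hψ, div_pow, mul_pow, hexp, Real.sq_sqrt (hhpos u hu k).le, eval_mul, eval_X]
    ring
  have hψderiv (k : ℕ) : HasDerivAt (fun t => ψ (Function.update u i₀ t) k x)
      ((q k).eval x * Real.exp (-(Vf u x) / 2) / Real.sqrt (h u k) -
        (x - β u k) / 2 * ψ u k x) t₀ := by
    have hh' : HasDerivAt (fun t => h (Function.update u i₀ t) k) (-(β u k * h u k)) t₀ := by
      rw [hβL, hLh, div_mul_cancel₀ _ (hhpos u hu k).ne']
      simpa only [hh, hVt, eval_mul, pow_two] using hqh k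
    have heval : HasDerivAt (fun t => (p (Function.update u i₀ t) k).eval x)
        ((q k).eval x) t₀ :=
      (hq k).eval (N := k) (hmem.mono fun t ht => (hpdeg _ ht k).le) x
    have hexp : HasDerivAt (fun t => Real.exp (-(Vf (Function.update u i₀ t) x) / 2))
        (Real.exp (-(Vf u x) / 2) * (-x / 2)) t₀ := by
      simp only [hVt, hVu]
      have hlin : HasDerivAt (fun s : ℝ => -(v x + s * x) / 2) (-x / 2) t₀ := by
        simpa using ((((hasDerivAt_id t₀).mul_const x).const_add (v x)).neg).div_const 2
      exact hlin.exp
    have hne : h (Function.update u i₀ t₀) k ≠ 0 := by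
      rw [hupd]
      exact (hhpos u hu k).ne'
    have hs : Real.sqrt (h u k) ≠ 0 := (Real.sqrt_pos.2 (hhpos u hu k)).ne'
    have hquot := (heval.mul hexp).div (hh'.sqrt hne) (by rwa [hupd])
    simp only [hupd] at hquot
    simp only [hψ]
    refine hquot.congr_deriv ?_
    simp only [Pi.mul_apply, hupd]
    obtain ⟨s, hsdef⟩ : ∃ s, s = Real.sqrt (h u k) := ⟨_, rfl⟩
    have hsq : h u k = s ^ 2 := by rw [hsdef, Real.sq_sqrt (hhpos u hu k).le]
    rw [← hsdef] at hs ⊢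
    rw [hsq]
    field_simp
    ring
  obtain ⟨m, rfl⟩ : ∃ m, n = m + 1 := ⟨n - 1, by omega⟩
  simp only [Nat.add_sub_cancel]
  have hsm : Real.sqrt (h u m) ≠ 0 := (Real.sqrt_pos.2 (hhpos u hu m)).ne'
  have hsn : Real.sqrt (h u (m + 1)) ≠ 0 := (Real.sqrt_pos.2 (hhpos u hu (m + 1))).ne'
  have hγs : γ u (m + 1) = Real.sqrt (h u (m + 1)) / Real.sqrt (h u m) := by
    rw [hγ u (m + 1) hn, Nat.add_sub_cancel, Real.sqrt_div (hhpos u hu (m + 1)).le]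
  constructor
  · refine (hψderiv m).congr_deriv ?_
    rw [eq_X_sub_C_mul_sub_succ_of_map_mul_eq (hmonic u hu) (hpdeg u hu) horthL hLne
      (hqdeg m) (hqL m), ← hβL, hγs, hψ, hψ]
    simp only [eval_sub, eval_mul, eval_X, eval_smul, smul_eq_mul]
    field_simp
    ring
  · refine (hψderiv (m + 1)).congr_deriv ?_
    rw [eq_smul_pred_of_map_mul_eq (hmonic u hu) (hpdeg u hu) horthL hLne
      (hqdeg (m + 1)) (hqL (m + 1)), hLh, hLh, hγs, hψ, hψ, eval_smul, smul_eq_mul]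
    have hsqm := Real.sq_sqrt (hhpos u hu m).le
    have hsqn := Real.sq_sqrt (hhpos u hu (m + 1)).le
    obtain ⟨a, ha⟩ : ∃ a, a = Real.sqrt (h u m) := ⟨_, rfl⟩
    obtain ⟨b, hb⟩ : ∃ b, b = Real.sqrt (h u (m + 1)) := ⟨_, rfl⟩
    rw [← ha] at hsm hsqm ⊢
    rw [← hb] at hsn hsqn ⊢
    rw [← hsqm, ← hsqn]
    field_simp
    ring
end

section
/- (Recursion between consecutive deformation equations.) For every u ∈ U, every k with 1 ≤ k ≤ D − 1, every n ≥ 1 and every x ∈ ℝ: −2(k+1) ∂ψ_n/∂u_{k+1} (u, x) = −2k x ∂ψ_n/∂u_k (u, x) + M^k_{n,n}(u) [ (x − β_n(u)) ψ_n(u, x) − 2 γ_n(u) ψ_{n−1}(u, x) ] + [ γ_n(u) M^k_{n,n−1}(u) − γ_{n+1}(u) M^k_{n,n+1}(u) ] ψ_n(u, x). -/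
open MeasureTheory Polynomial Real

/-- The linear functional `q ↦ ∫ q exp (-V)` on polynomials. -/
noncomputable def gibbsFunctional (V : ℝ → ℝ)
    (hV : ∀ q : ℝ[X], Integrable (fun x : ℝ => q.eval x * Real.exp (-(V x)))) :
    ℝ[X] →ₗ[ℝ] ℝ where
  toFun q := ∫ x : ℝ, q.eval x * Real.exp (-(V x))
  map_add' q r := by
    simp only [eval_add, add_mul]
    exact integral_add (hV q) (hV r)
  map_smul' c q := by
    simp only [eval_smul, smul_eq_mul, mul_assoc, RingHom.id_apply]
    exact integral_const_mul _ _

theorem gibbsFunctional_apply (V : ℝ → ℝ)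
    (hV : ∀ q : ℝ[X], Integrable (fun x : ℝ => q.eval x * Real.exp (-(V x)))) (q : ℝ[X]) :
    gibbsFunctional V hV q = ∫ x : ℝ, q.eval x * Real.exp (-(V x)) := rfl

section Orthogonal

variable {L : ℝ[X] →ₗ[ℝ] ℝ} {P : ℕ → ℝ[X]}

theorem degree_le_of_lt_succ {r : ℝ[X]} {m : ℕ} (hr : r.degree < ((m + 1 : ℕ) : WithBot ℕ)) :
    r.degree ≤ m := by
  refine (degree_le_iff_coeff_zero _ _).2 fun j hj => ?_
  exact (degree_lt_iff_coeff_zero _ _).1 hr j (by exact_mod_cast hj)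

theorem degree_sub_leading_lt {p r : ℝ[X]} {d : ℕ} (hp : p.Monic) (hpd : p.natDegree = d)
    (hr : r.degree ≤ d) : (r - C (r.coeff d) * p).degree < d := by
  refine (degree_lt_iff_coeff_zero _ _).2 fun m hm => ?_
  rcases hm.eq_or_lt with rfl | hm
  · have : p.coeff d = 1 := by rw [← hpd]; exact hp
    simp [this]
  · have h1 : r.coeff m = 0 :=
      coeff_eq_zero_of_degree_lt (hr.trans_lt (by exact_mod_cast hm))
    have h2 : p.coeff m = 0 := coeff_eq_zero_of_natDegree_lt (hpd ▸ hm)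
    simp [h1, h2]

/-- A monic orthogonal polynomial is orthogonal to everything of smaller degree. -/
theorem orthogonal_of_degree_lt (hm : ∀ n, (P n).Monic) (hd : ∀ n, (P n).natDegree = n)
    (ho : ∀ n m, n ≠ m → L (P n * P m) = 0) {n : ℕ} {r : ℝ[X]} (hr : r.degree < n) :
    L (P n * r) = 0 := by
  suffices H : ∀ d : ℕ, d ≤ n → ∀ r : ℝ[X], r.degree < d → L (P n * r) = 0 from H n le_rfl r hr
  intro d
  induction d with
  | zero =>
    intro _ r hr
    have : r = 0 := by
      rw [← degree_eq_bot]
      simpa [Nat.WithBot.lt_zero_iff] using hr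
    simp [this]
  | succ d ih =>
    intro hdn r hr
    have h1 := ih (by omega) _ (degree_sub_leading_lt (hm d) (hd d)
      (degree_le_of_lt_succ hr))
    have h2 : P n * r = P n * (r - C (r.coeff d) * P d) + r.coeff d • (P n * P d) := by
      rw [smul_eq_C_mul]; ring
    rw [h2, map_add, map_smul, h1, ho n d (by omega)]
    simp

theorem pairing_eq_coeff_mul (hm : ∀ n, (P n).Monic) (hd : ∀ n, (P n).natDegree = n)
    (ho : ∀ n m, n ≠ m → L (P n * P m) = 0) {n : ℕ} {r : ℝ[X]} (hr : r.degree ≤ n) :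
    L (P n * r) = r.coeff n * L (P n * P n) := by
  have h1 := orthogonal_of_degree_lt hm hd ho (degree_sub_leading_lt (hm n) (hd n) hr)
  have h2 : P n * r = P n * (r - C (r.coeff n) * P n) + r.coeff n • (P n * P n) := by
    rw [smul_eq_C_mul]; ring
  rw [h2, map_add, map_smul, h1]
  simp

/-- Nondegeneracy of the pairing on polynomials of bounded degree. -/
theorem eq_zero_of_pairing_eq_zero (hm : ∀ n, (P n).Monic) (hd : ∀ n, (P n).natDegree = n)
    (ho : ∀ n m, n ≠ m → L (P n * P m) = 0) (hne : ∀ n, L (P n * P n) ≠ 0) {N : ℕ} {Z : ℝ[X]}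
    (hZ : Z.degree < N) (hL : ∀ r : ℝ[X], r.degree < N → L (Z * r) = 0) : Z = 0 := by
  by_contra h0
  have hlt : Z.natDegree < N := (natDegree_lt_iff_degree_lt h0).2 hZ
  have h1 := hL (P Z.natDegree) (degree_le_natDegree.trans_lt (by rw [hd]; exact_mod_cast hlt))
  rw [mul_comm, pairing_eq_coeff_mul hm hd ho degree_le_natDegree] at h1
  rcases mul_eq_zero.1 h1 with h2 | h2
  · exact h0 (leadingCoeff_eq_zero.1 h2)
  · exact hne _ h2

theorem degree_X_mul_le {r : ℝ[X]} {m : ℕ} (hr : r.degree < ((m + 1 : ℕ) : WithBot ℕ)) :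
    (X * r).degree ≤ ((m + 1 : ℕ) : WithBot ℕ) := by
  refine (degree_le_iff_coeff_zero _ _).2 fun j hj => ?_
  have hj : m + 1 < j := by exact_mod_cast hj
  obtain ⟨j, rfl⟩ : ∃ l, j = l + 1 := ⟨j - 1, by omega⟩
  rw [coeff_X_mul]
  exact (degree_lt_iff_coeff_zero _ _).1 hr j (by omega)

/-- If `A` and `B` are the projections of `Q` and `X * Q` onto polynomials of degree at most `m`,
then `B - X * A` is a combination of `P m` and `P (m + 1)`. -/
theorem projection_X_mul (hm : ∀ n, (P n).Monic) (hd : ∀ n, (P n).natDegree = n)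
    (ho : ∀ n m, n ≠ m → L (P n * P m) = 0) (hne : ∀ n, L (P n * P n) ≠ 0) {m : ℕ}
    {A B Q : ℝ[X]} (hA : A.degree < (m + 1 : ℕ)) (hB : B.degree < (m + 1 : ℕ))
    (hAQ : ∀ r : ℝ[X], r.degree < (m + 1 : ℕ) → L (A * r) = L (Q * r))
    (hBQ : ∀ r : ℝ[X], r.degree < (m + 1 : ℕ) → L (B * r) = L (X * Q * r)) :
    B = X * A + C (L (Q * P (m + 1)) / L (P m * P m)) * P m
      - C (L (Q * P m) / L (P m * P m)) * P (m + 1) := by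
  have hdeg : ∀ n, (P n).degree = n := fun n => by
    rw [degree_eq_natDegree (hm n).ne_zero, hd]
  have hPm : (P m).degree < (m + 1 : ℕ) := by rw [hdeg]; exact_mod_cast Nat.lt_succ_self m
  have ha : A.coeff m = L (Q * P m) / L (P m * P m) := by
    rw [eq_div_iff (hne m), ← pairing_eq_coeff_mul hm hd ho (degree_le_of_lt_succ hA), mul_comm,
      hAQ _ hPm]
  have hXA := degree_sub_leading_lt (hm (m + 1)) (hd (m + 1)) (degree_X_mul_le hA)
  rw [coeff_X_mul, ha] at hXA
  set a := L (Q * P m) / L (P m * P m)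
  set b := L (Q * P (m + 1)) / L (P m * P m)
  have hbm : (C b * P m).degree < (m + 1 : ℕ) := by
    rw [← smul_eq_C_mul]; exact (degree_smul_le _ _).trans_lt hPm
  suffices H : B - (X * A - C a * P (m + 1)) - C b * P m = 0 by linear_combination H
  refine eq_zero_of_pairing_eq_zero hm hd ho hne (N := m + 1)
    ((degree_sub_le _ _).trans_lt (max_lt ((degree_sub_le _ _).trans_lt (max_lt hB hXA)) hbm)) ?_
  intro r hr
  have hXr := degree_sub_leading_lt (hm (m + 1)) (hd (m + 1)) (degree_X_mul_le hr)
  rw [coeff_X_mul] at hXr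
  set s := X * r - C (r.coeff m) * P (m + 1) with hs
  have e : (B - (X * A - C a * P (m + 1)) - C b * P m) * r
      = B * r - A * s - r.coeff m • (P (m + 1) * A) + a • (P (m + 1) * r) - b • (P m * r) := by
    simp only [smul_eq_C_mul, hs]; ring
  have e2 : X * Q * r = Q * s + r.coeff m • (Q * P (m + 1)) := by
    simp only [smul_eq_C_mul, hs]; ring
  rw [e, map_sub, map_add, map_sub, map_sub, map_smul, map_smul, map_smul, hBQ r hr, hAQ s hXr,
    orthogonal_of_degree_lt hm hd ho hA, orthogonal_of_degree_lt hm hd ho hr,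
    pairing_eq_coeff_mul hm hd ho (degree_le_of_lt_succ hr), e2, map_add, map_smul]
  have : b * L (P m * P m) = L (Q * P (m + 1)) := div_mul_cancel₀ _ (hne m)
  simp only [smul_eq_mul]
  linear_combination (-r.coeff m) * this

/-- The three-term recurrence. -/
theorem three_term_recurrence (hm : ∀ n, (P n).Monic) (hd : ∀ n, (P n).natDegree = n)
    (ho : ∀ n m, n ≠ m → L (P n * P m) = 0) (hne : ∀ n, L (P n * P n) ≠ 0) (m : ℕ) :
    X * P (m + 1) = P (m + 2)
      + C (L (X * P (m + 1) * P (m + 1)) / L (P (m + 1) * P (m + 1))) * P (m + 1)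
      + C (L (P (m + 1) * P (m + 1)) / L (P m * P m)) * P m := by
  have hdeg : ∀ n, (P n).degree = n := fun n => by
    rw [degree_eq_natDegree (hm n).ne_zero, hd]
  have hlt : ∀ {i j : ℕ}, i < j → (P i).degree < j := fun hij => by
    rw [hdeg]; exact_mod_cast hij
  set b := L (X * P (m + 1) * P (m + 1)) / L (P (m + 1) * P (m + 1))
  set g := L (P (m + 1) * P (m + 1)) / L (P m * P m)
  have hX := degree_sub_leading_lt (hm (m + 2)) (hd (m + 2))
    (degree_X_mul_le (m := m + 1) (hlt (by omega : m + 1 < m + 1 + 1)))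
  have hc : (P (m + 1)).coeff (m + 1) = 1 := by
    have := hm (m + 1); rwa [Monic, leadingCoeff, hd] at this
  rw [coeff_X_mul, hc, C_1, one_mul] at hX
  have hbm : (C b * P (m + 1)).degree < (m + 2 : ℕ) := by
    rw [← smul_eq_C_mul]; exact (degree_smul_le _ _).trans_lt (hlt (by omega))
  have hgm : (C g * P m).degree < (m + 2 : ℕ) := by
    rw [← smul_eq_C_mul]; exact (degree_smul_le _ _).trans_lt (hlt (by omega))
  suffices H : X * P (m + 1) - P (m + 2) - C b * P (m + 1) - C g * P m = 0 by
    linear_combination H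
  refine eq_zero_of_pairing_eq_zero hm hd ho hne (N := m + 2)
    ((degree_sub_le _ _).trans_lt (max_lt ((degree_sub_le _ _).trans_lt (max_lt hX hbm)) hgm)) ?_
  intro r hr
  have hs := degree_sub_leading_lt (hm (m + 1)) (hd (m + 1)) (degree_le_of_lt_succ hr)
  set c := r.coeff (m + 1)
  set s := r - C c * P (m + 1) with hs'
  have e : (X * P (m + 1) - P (m + 2) - C b * P (m + 1) - C g * P m) * r
      = P (m + 1) * (X * s) + c • (X * P (m + 1) * P (m + 1)) - P (m + 2) * r
        - b • (P (m + 1) * s) - (b * c) • (P (m + 1) * P (m + 1))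
        - g • (P m * s) - (g * c) • (P m * P (m + 1)) := by
    simp only [smul_eq_C_mul, hs', C_mul]; ring
  rw [e]
  simp only [map_sub, map_add, map_smul, smul_eq_mul]
  rw [pairing_eq_coeff_mul hm hd ho (degree_X_mul_le hs), coeff_X_mul,
    orthogonal_of_degree_lt hm hd ho hr, orthogonal_of_degree_lt hm hd ho hs,
    pairing_eq_coeff_mul hm hd ho (degree_le_of_lt_succ hs), ho m (m + 1) (by omega)]
  have h1 : b * L (P (m + 1) * P (m + 1)) = L (X * P (m + 1) * P (m + 1)) :=
    div_mul_cancel₀ _ (hne _)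
  have h2 : g * L (P m * P m) = L (P (m + 1) * P (m + 1)) := div_mul_cancel₀ _ (hne m)
  linear_combination (-c) * h1 - s.coeff m * h2

end Orthogonal

/-- Differentiation under the integral for an exponential weight moving along a line. -/
theorem hasDerivAt_integral_weight {V : ℝ → ℝ} {φ : ℝ[X]} {s₀ : ℝ}
    (hV : ∀ᶠ s in nhds s₀, ∀ q : ℝ[X],
      Integrable (fun x : ℝ => q.eval x * Real.exp (-(V x + (s - s₀) * φ.eval x)))) (q : ℝ[X]) :
    HasDerivAt (fun s => ∫ x : ℝ, q.eval x * Real.exp (-(V x + (s - s₀) * φ.eval x)))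
      (∫ x : ℝ, (-(φ * q)).eval x * Real.exp (-(V x))) s₀ := by
  obtain ⟨ε, hε, hball⟩ := Metric.eventually_nhds_iff.1 hV
  have hd : 0 < ε / 2 := by linarith
  have hp := hball (y := s₀ + ε / 2) (by simp [abs_of_pos hε, hε])
  have hm := hball (y := s₀ - ε / 2) (by simp [abs_of_pos hε, hε])
  simp only [add_sub_cancel_left, sub_sub_cancel_left] at hp hm
  have h := hasDerivAt_integral_of_dominated_loc_of_deriv_le (μ := (volume : Measure ℝ))
    (F := fun s x => q.eval x * Real.exp (-(V x + (s - s₀) * φ.eval x)))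
    (F' := fun s x => (-(φ * q)).eval x * Real.exp (-(V x + (s - s₀) * φ.eval x)))
    (x₀ := s₀) (s := Metric.ball s₀ (ε / 2))
    (bound := fun x => ‖(φ * q).eval x * Real.exp (-(V x + ε / 2 * φ.eval x))‖
      + ‖(φ * q).eval x * Real.exp (-(V x + -(ε / 2) * φ.eval x))‖)
    (Metric.ball_mem_nhds s₀ hd) (hV.mono fun s hs => (hs q).aestronglyMeasurable)
    (hV.self_of_nhds q) (hV.self_of_nhds _).aestronglyMeasurable
    (Filter.Eventually.of_forall fun x s hs => ?_)
    ((hp _).norm.add (hm _).norm) (Filter.Eventually.of_forall fun x s _ => ?_)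
  · simpa using h.2
  · rw [Metric.mem_ball, Real.dist_eq, abs_lt] at hs
    simp only [norm_mul, eval_neg, norm_neg, Real.norm_eq_abs, Real.abs_exp, ← mul_add]
    refine mul_le_mul_of_nonneg_left ?_ (abs_nonneg _)
    rcases le_total 0 (φ.eval x) with h0 | h0
    · refine le_trans (Real.exp_le_exp.2 ?_) (le_add_of_nonneg_left (Real.exp_pos _).le)
      nlinarith
    · refine le_trans (Real.exp_le_exp.2 ?_) (le_add_of_nonneg_right (Real.exp_pos _).le)
      nlinarith
  · have h1 : HasDerivAt (fun s : ℝ => -(V x + (s - s₀) * φ.eval x)) (-(1 * φ.eval x)) s :=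
      ((((hasDerivAt_id s).sub_const s₀).mul_const _).const_add _).neg
    refine (h1.exp.const_mul (q.eval x)).congr_deriv ?_
    simp only [eval_neg, eval_mul]
    ring

/-- First variation of a monic polynomial of fixed degree together with its weight. -/
theorem exists_variation {V : ℝ → ℝ} {φ : ℝ[X]} {s₀ : ℝ}
    (hV : ∀ᶠ s in nhds s₀, ∀ q : ℝ[X],
      Integrable (fun x : ℝ => q.eval x * Real.exp (-(V x + (s - s₀) * φ.eval x))))
    (hV₀ : ∀ q : ℝ[X], Integrable (fun x : ℝ => q.eval x * Real.exp (-(V x))))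
    {P : ℝ → ℝ[X]} {n : ℕ}
    (hP : ∀ᶠ s in nhds s₀, (P s).Monic ∧ (P s).natDegree = n)
    (hc : ∀ j, DifferentiableAt ℝ (fun s => (P s).coeff j) s₀) :
    ∃ A : ℝ[X], A.degree < n ∧ (∀ x, HasDerivAt (fun s => (P s).eval x) (A.eval x) s₀) ∧
      ∀ r : ℝ[X], HasDerivAt
        (fun s => ∫ x : ℝ, (P s * r).eval x * Real.exp (-(V x + (s - s₀) * φ.eval x)))
        (gibbsFunctional V hV₀ (A * r) - gibbsFunctional V hV₀ (φ * P s₀ * r)) s₀ := by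
  have hexp : ∀ᶠ s in nhds s₀,
      P s = X ^ n + ∑ j ∈ Finset.range n, C ((P s).coeff j) * X ^ j := by
    filter_upwards [hP] with s hs
    conv_lhs => rw [hs.1.as_sum, hs.2]
  refine ⟨∑ j ∈ Finset.range n, C (deriv (fun s => (P s).coeff j) s₀) * X ^ j, ?_, ?_, ?_⟩
  · refine (degree_sum_le _ _).trans_lt ((Finset.sup_lt_iff (WithBot.bot_lt_coe n)).2 ?_)
    intro j hj
    exact (degree_C_mul_X_pow_le _ _).trans_lt (WithBot.coe_lt_coe.2 (Finset.mem_range.1 hj))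
  · intro x
    have h1 : HasDerivAt (fun s => x ^ n + ∑ j ∈ Finset.range n, (P s).coeff j * x ^ j)
        (∑ j ∈ Finset.range n, deriv (fun s => (P s).coeff j) s₀ * x ^ j) s₀ :=
      (HasDerivAt.fun_sum fun j _ => (hc j).hasDerivAt.mul_const _).const_add _
    refine (h1.congr_of_eventuallyEq ?_).congr_deriv ?_
    · filter_upwards [hexp] with s hs
      conv_lhs => rw [hs]
      simp [eval_finsetSum]
    · simp [eval_finsetSum]
  · intro r
    have hw := hasDerivAt_integral_weight hV
    have h1 := (hw (X ^ n * r)).add (HasDerivAt.fun_sum (u := Finset.range n)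
      fun j _ => (hc j).hasDerivAt.mul (hw (X ^ j * r)))
    refine (h1.congr_of_eventuallyEq ?_).congr_deriv ?_
    · filter_upwards [hexp, hV] with s hs hVs
      have e : P s * r = X ^ n * r + ∑ j ∈ Finset.range n, (P s).coeff j • (X ^ j * r) := by
        conv_lhs => rw [hs]
        simp only [add_mul, Finset.sum_mul, smul_eq_C_mul, mul_assoc]
      have := congrArg (gibbsFunctional (fun x => V x + (s - s₀) * φ.eval x) hVs) e
      simp only [map_add, map_sum, map_smul, gibbsFunctional_apply, smul_eq_mul] at this
      simpa using this
    · simp only [sub_self, zero_mul, add_zero, ← gibbsFunctional_apply V hV₀]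
      have e1 : (∑ j ∈ Finset.range n, C (deriv (fun s => (P s).coeff j) s₀) * X ^ j) * r
          = ∑ j ∈ Finset.range n, deriv (fun s => (P s).coeff j) s₀ • (X ^ j * r) := by
        simp only [Finset.sum_mul, smul_eq_C_mul, mul_assoc]
      have e2 : φ * P s₀ * r = -(-(φ * (X ^ n * r))
          + ∑ j ∈ Finset.range n, (P s₀).coeff j • -(φ * (X ^ j * r))) := by
        conv_lhs => rw [hexp.self_of_nhds]
        simp only [smul_eq_C_mul, mul_neg, Finset.sum_neg_distrib, neg_add, neg_neg, mul_add,
          add_mul, Finset.sum_mul, Finset.mul_sum]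
        congr 1
        · ring
        · exact Finset.sum_congr rfl fun j _ => by ring
      rw [e1, e2]
      simp only [map_neg, map_add, map_sum, map_smul, smul_eq_mul, Finset.sum_add_distrib]
      ring

theorem stmt17
    (D : ℕ) (hDeven : Even D) (hD2 : 2 ≤ D)
    (U : Set (Fin D → ℝ)) (hUopen : IsOpen U)
    (hUpos : ∀ u ∈ U, 0 < u ⟨D - 1, by omega⟩)
    (Vf : (Fin D → ℝ) → ℝ → ℝ)
    (hVf : ∀ (u : Fin D → ℝ) (x : ℝ),
      Vf u x = ∑ i : Fin D, u i / ((i : ℕ) + 1) * x ^ ((i : ℕ) + 1))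
    (hint : ∀ u ∈ U, ∀ q : Polynomial ℝ,
      Integrable (fun x : ℝ => q.eval x * Real.exp (-(Vf u x))))
    (p : (Fin D → ℝ) → ℕ → Polynomial ℝ)
    (hmonic : ∀ u ∈ U, ∀ n, (p u n).Monic)
    (hpdeg : ∀ u ∈ U, ∀ n, (p u n).natDegree = n)
    (horth : ∀ u ∈ U, ∀ n m, n ≠ m →
      ∫ x : ℝ, (p u n).eval x * (p u m).eval x * Real.exp (-(Vf u x)) = 0)
    (h : (Fin D → ℝ) → ℕ → ℝ)
    (hh : ∀ (u : Fin D → ℝ) (n : ℕ),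
      h u n = ∫ x : ℝ, ((p u n).eval x) ^ 2 * Real.exp (-(Vf u x)))
    (hhpos : ∀ u ∈ U, ∀ n, 0 < h u n)
    (ψ : (Fin D → ℝ) → ℕ → ℝ → ℝ)
    (hψ : ∀ (u : Fin D → ℝ) (n : ℕ) (x : ℝ),
      ψ u n x = (p u n).eval x * Real.exp (-(Vf u x) / 2) / Real.sqrt (h u n))
    (hcoeff : ∀ n j, DifferentiableOn ℝ (fun u => (p u n).coeff j) U)
    (γ : (Fin D → ℝ) → ℕ → ℝ)
    (hγ : ∀ (u : Fin D → ℝ) (n : ℕ), 1 ≤ n → γ u n = Real.sqrt (h u n / h u (n - 1)))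
    (β : (Fin D → ℝ) → ℕ → ℝ)
    (hβ : ∀ (u : Fin D → ℝ) (n : ℕ), β u n = ∫ x : ℝ, x * (ψ u n x) ^ 2)
    (M : (Fin D → ℝ) → ℕ → ℕ → ℕ → ℝ)
    (hM : ∀ (u : Fin D → ℝ) (k a b : ℕ),
      M u k a b = ∫ t : ℝ, t ^ k * ψ u a t * ψ u b t)
    (u : Fin D → ℝ) (hu : u ∈ U) (i : Fin D) (hi : (i : ℕ) + 1 ≤ D - 1)
    (n : ℕ) (hn : 1 ≤ n) (x : ℝ) :
    -(2 * (((i : ℕ) + 1 : ℝ) + 1))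
        * deriv (fun t => ψ (Function.update u ⟨(i : ℕ) + 1, by omega⟩ t) n x)
            (u ⟨(i : ℕ) + 1, by omega⟩)
      = -(2 * ((i : ℕ) + 1 : ℝ)) * x
            * deriv (fun t => ψ (Function.update u i t) n x) (u i)
        + M u ((i : ℕ) + 1) n n
            * ((x - β u n) * ψ u n x - 2 * γ u n * ψ u (n - 1) x)
        + (γ u n * M u ((i : ℕ) + 1) n (n - 1)
            - γ u (n + 1) * M u ((i : ℕ) + 1) n (n + 1)) * ψ u n x := by
  obtain ⟨m, rfl⟩ : ∃ m, n = m + 1 := ⟨n - 1, by omega⟩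
  set L := gibbsFunctional (Vf u) (hint u hu) with hL
  have hLh : ∀ a, L (p u a * p u a) = h u a := fun a => by
    simp only [hL, gibbsFunctional_apply, hh, eval_mul, sq]
  have hm := hmonic u hu
  have hd := hpdeg u hu
  have ho : ∀ a b, a ≠ b → L (p u a * p u b) = 0 := fun a b hab => by
    simpa only [hL, gibbsFunctional_apply, eval_mul] using horth u hu a b hab
  have hpos := hhpos u hu
  have hne : ∀ a, L (p u a * p u a) ≠ 0 := fun a => by rw [hLh]; exact (hpos a).ne'
  have hMeq : ∀ k a b, M u k a b = L (X ^ k * p u a * p u b) / (√(h u a) * √(h u b)) := by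
    intro k a b
    rw [hM, hL, gibbsFunctional_apply, ← integral_div]
    refine integral_congr_ae (Filter.Eventually.of_forall fun t => ?_)
    have e : Real.exp (-(Vf u t)) = Real.exp (-(Vf u t) / 2) * Real.exp (-(Vf u t) / 2) := by
      rw [← Real.exp_add]; ring_nf
    simp only [hψ, eval_mul, eval_pow, eval_X, e]
    ring
  have hβeq : β u (m + 1) = L (X * p u (m + 1) * p u (m + 1)) / h u (m + 1) := by
    have h1 : β u (m + 1) = M u 1 (m + 1) (m + 1) := by
      rw [hβ, hM]
      exact integral_congr_ae (Filter.Eventually.of_forall fun t => by ring)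
    rw [h1, hMeq, pow_one, Real.mul_self_sqrt (hpos _).le]
  have key : ∀ j : Fin D, ∃ A : ℝ[X], A.degree < ((m + 1 : ℕ) : WithBot ℕ) ∧
      (∀ r : ℝ[X], r.degree < ((m + 1 : ℕ) : WithBot ℕ) →
        L (A * r) = L (X ^ ((j : ℕ) + 1) * p u (m + 1) * r)) ∧
      ∀ y : ℝ, 2 * ((j : ℕ) + 1 : ℝ) *
          deriv (fun t => ψ (Function.update u j t) (m + 1) y) (u j)
        = (2 * A.eval y - y ^ ((j : ℕ) + 1) * (p u (m + 1)).eval y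
            + L (X ^ ((j : ℕ) + 1) * p u (m + 1) * p u (m + 1)) / h u (m + 1)
              * (p u (m + 1)).eval y) * Real.exp (-(Vf u y) / 2) / √(h u (m + 1)) := by
    intro j
    have hk : ((j : ℕ) + 1 : ℝ) ≠ 0 := by positivity
    set k : ℝ := (j : ℕ) + 1 with hkdef
    set φ : ℝ[X] := C (1 / k) * X ^ ((j : ℕ) + 1) with hφ
    have hVu : ∀ s y, Vf (Function.update u j s) y = Vf u y + (s - u j) * φ.eval y := by
      intro s y
      have e : ∀ l : Fin D, Function.update u j s l / ((l : ℕ) + 1) * y ^ ((l : ℕ) + 1)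
          = u l / ((l : ℕ) + 1) * y ^ ((l : ℕ) + 1)
            + if l = j then (s - u j) * φ.eval y else 0 := by
        intro l
        by_cases hl : l = j
        · subst hl
          simp only [Function.update_self, if_true, hφ, eval_mul, eval_C, eval_pow, eval_X, hkdef]
          ring
        · simp [hl]
      rw [hVf, hVf, Finset.sum_congr rfl fun l _ => e l, Finset.sum_add_distrib]
      simp
    have hup : HasDerivAt (Function.update u j) (Pi.single j 1) (u j) :=
      hasDerivAt_update u j (u j)
    have hself : Function.update u j (u j) = u := Function.update_eq_self j u
    have hUev : ∀ᶠ s in nhds (u j), Function.update u j s ∈ U := by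
      refine hup.continuousAt.eventually_mem ?_
      rw [hself]
      exact hUopen.mem_nhds hu
    obtain ⟨A, hA, hAd, hAL⟩ := exists_variation (V := Vf u) (φ := φ) (s₀ := u j)
      (hUev.mono fun s hs q => by simpa only [hVu] using hint _ hs q) (hint u hu)
      (P := fun s => p (Function.update u j s) (m + 1)) (n := m + 1)
      (hUev.mono fun s hs => ⟨hmonic _ hs _, hpdeg _ hs _⟩)
      (fun l => by
        have h1 : DifferentiableAt ℝ (fun v => (p v (m + 1)).coeff l)
            (Function.update u j (u j)) := by
          rw [hself]
          exact (hcoeff (m + 1) l).differentiableAt (hUopen.mem_nhds hu)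
        exact h1.comp (u j) hup.differentiableAt)
    simp only [hself, ← hVu, ← hL] at hAL
    have hφL : ∀ r, L (φ * p u (m + 1) * r) = L (X ^ ((j : ℕ) + 1) * p u (m + 1) * r) / k := by
      intro r
      have : φ * p u (m + 1) * r = (1 / k) • (X ^ ((j : ℕ) + 1) * p u (m + 1) * r) := by
        rw [smul_eq_C_mul, hφ]; ring
      rw [this, map_smul, smul_eq_mul]
      ring
    have hproj : ∀ r : ℝ[X], r.degree ≤ ((m + 1 : ℕ) : WithBot ℕ) →
        HasDerivAt (fun s => r.coeff (m + 1) * h (Function.update u j s) (m + 1))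
          (L (A * r) - L (X ^ ((j : ℕ) + 1) * p u (m + 1) * r) / k) (u j) := by
      intro r hr
      rw [← hφL]
      refine (hAL r).congr_of_eventuallyEq ?_
      filter_upwards [hUev] with s hs
      have := pairing_eq_coeff_mul (L := gibbsFunctional _ (hint _ hs)) (hmonic _ hs)
        (hpdeg _ hs) (fun a b hab => by
          simpa only [gibbsFunctional_apply, eval_mul] using horth _ hs a b hab) hr
      simp only [gibbsFunctional_apply] at this
      rw [this, hh]
      simp only [eval_mul, sq]
    have hdp : (p u (m + 1)).degree = ((m + 1 : ℕ) : WithBot ℕ) := by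
      rw [degree_eq_natDegree (hm _).ne_zero, hd]
    have hc1 : (p u (m + 1)).coeff (m + 1) = 1 := by
      have := hm (m + 1); rwa [Monic, leadingCoeff, hd] at this
    have hhd := hproj (p u (m + 1)) hdp.le
    rw [mul_comm A, orthogonal_of_degree_lt hm hd ho hA, hc1] at hhd
    simp only [one_mul] at hhd
    refine ⟨C k * A, ?_, ?_, ?_⟩
    · rw [← smul_eq_C_mul]; exact (degree_smul_le _ _).trans_lt hA
    · intro r hr
      have h1 := hproj r hr.le
      have h0 : r.coeff (m + 1) = 0 := coeff_eq_zero_of_degree_lt hr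
      simp only [h0, zero_mul] at h1
      have h2 := h1.unique (hasDerivAt_const _ _)
      rw [mul_assoc, ← smul_eq_C_mul, map_smul, smul_eq_mul, sub_eq_zero.1 h2]
      field_simp
    · intro y
      have hVd : HasDerivAt (fun s => Real.exp (-(Vf (Function.update u j s) y) / 2))
          (Real.exp (-(Vf u y) / 2) * (-(1 * φ.eval y) / 2)) (u j) := by
        have h1 : HasDerivAt (fun s => -(Vf (Function.update u j s) y) / 2)
            (-(1 * φ.eval y) / 2) (u j) := by
          simp only [hVu]
          exact (((((hasDerivAt_id _).sub_const (u j)).mul_const _).const_add _).neg).div_const 2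
        simpa only [hself] using h1.exp
      have hs := hhd.sqrt (by rw [hself]; exact (hpos _).ne')
      have h3 := ((hAd y).mul hVd).div hs (by
        rw [hself]; exact (Real.sqrt_pos.2 (hpos _)).ne')
      rw [(h3.congr_of_eventuallyEq (Filter.Eventually.of_forall fun t => hψ _ _ _)).deriv]
      simp only [hself, Pi.mul_apply]
      have hsq : √(h u (m + 1)) ^ 2 = h u (m + 1) := Real.sq_sqrt (hpos _).le
      have hs0 : √(h u (m + 1)) ≠ 0 := (Real.sqrt_pos.2 (hpos _)).ne'
      rw [← hsq, Real.sqrt_sq (Real.sqrt_nonneg _)]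
      simp only [hφ, eval_mul, eval_C, eval_pow, eval_X]
      field_simp
      ring
  obtain ⟨A, hA, hAQ, hAd⟩ := key i
  obtain ⟨B, hB, hBQ, hBd⟩ := key ⟨(i : ℕ) + 1, by omega⟩
  have hAd := hAd x
  have hBd := hBd x
  simp only at hBQ hBd
  set Q := X ^ ((i : ℕ) + 1) * p u (m + 1) with hQ
  have hXQ : ∀ r, (X : ℝ[X]) ^ ((i : ℕ) + 1 + 1) * p u (m + 1) * r = X * Q * r := fun r => by
    rw [hQ]; ring
  simp only [hXQ] at hBQ hBd
  have hproj := congrArg (eval x) (projection_X_mul hm hd ho hne hA hB hAQ hBQ)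
  have hrec := congrArg (fun q => L (Q * q)) (three_term_recurrence hm hd ho hne m)
  have hmul : ∀ c (a : ℕ), Q * (C c * p u a) = c • (Q * p u a) := fun c a => by
    rw [smul_eq_C_mul]; ring
  have hXp : Q * (X * p u (m + 1)) = X * Q * p u (m + 1) := by ring
  simp only [mul_add, hmul, map_add, map_smul, smul_eq_mul, hLh, hXp] at hrec
  rw [hrec] at hBd
  simp only [eval_add, eval_sub, eval_mul, eval_X, eval_C, hLh] at hproj
  rw [hproj] at hBd
  rw [hγ u (m + 1) (by omega), hγ u (m + 1 + 1) (by omega), hβeq, hMeq, hMeq, hMeq]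
  simp only [Nat.add_sub_cancel, ← hQ, hψ u]
  rw [Real.sqrt_div (hpos _).le, Real.sqrt_div (hpos _).le]
  have hsq : ∀ a, ∃ s : ℝ, 0 < s ∧ h u a = s ^ 2 := fun a =>
    ⟨√(h u a), Real.sqrt_pos.2 (hpos a), (Real.sq_sqrt (hpos a).le).symm⟩
  obtain ⟨s₀, hs₀, h₀⟩ := hsq m
  obtain ⟨s₁, hs₁, h₁⟩ := hsq (m + 1)
  obtain ⟨s₂, hs₂, h₂⟩ := hsq (m + 2)
  simp only [h₀, h₁, h₂, Real.sqrt_sq hs₀.le, Real.sqrt_sq hs₁.le, Real.sqrt_sq hs₂.le]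
    at hAd hBd ⊢
  push_cast at hBd
  linear_combination (norm := skip) x * hAd - hBd
  field_simp
  ring
end

section
/- (The x-derivative matrix as a combination of deformation matrices, P = Σ_k k u_{k+1} U_k.) For every u ∈ U and all n, m ∈ ℕ: ∫_ℝ (∂ψ_n/∂x)(u, x) ψ_m(u, x) dx = Σ_{k=1}^{D−1} k · u_{k+1} · ∫_ℝ (∂ψ_n/∂u_k)(u, x) ψ_m(u, x) dx, where ∂ψ_n/∂x denotes the derivative of ψ_n(u, ·) with respect to x and u_{k+1} is the (k+1)-st coordinate of u. -/
open MeasureTheory Polynomial Real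

/-- Differentiation under the integral sign of `∫ f exp (-(V + (t - a) g))` at `t = a`. -/
lemma hasDerivAt_integral_mul_exp_neg_add {V g f : ℝ → ℝ} {a ε : ℝ} (hε : 0 < ε)
    (hV : Continuous V) (hg : Continuous g) (hf : Continuous f)
    (hfi : Integrable fun x => f x * exp (-(V x)))
    (hp : Integrable fun x => g x * f x * exp (-(V x + ε * g x)))
    (hm : Integrable fun x => g x * f x * exp (-(V x + -ε * g x))) :
    HasDerivAt (fun t => ∫ x, f x * exp (-(V x + (t - a) * g x)))
      (∫ x, -(g x * f x) * exp (-(V x))) a := by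
  have key := hasDerivAt_integral_of_dominated_loc_of_deriv_le (μ := volume) (x₀ := a)
    (s := Metric.ball a ε)
    (F := fun t x => f x * exp (-(V x + (t - a) * g x)))
    (F' := fun t x => -(g x * f x) * exp (-(V x + (t - a) * g x)))
    (bound := fun x => ‖g x * f x * exp (-(V x + ε * g x))‖
      + ‖g x * f x * exp (-(V x + -ε * g x))‖)
    (Metric.ball_mem_nhds a hε)
    (Filter.Eventually.of_forall fun t =>
      (by fun_prop : Continuous fun x => f x * exp (-(V x + (t - a) * g x))).aestronglyMeasurable)
    (by simpa using hfi)
    ((by fun_prop : Continuous fun x =>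
      -(g x * f x) * exp (-(V x + (a - a) * g x))).aestronglyMeasurable)
    (Filter.Eventually.of_forall fun x t ht => ?_) (hp.norm.add hm.norm)
    (Filter.Eventually.of_forall fun x t _ => ?_)
  · simpa using key.2
  · rw [Metric.mem_ball, Real.dist_eq, abs_lt] at ht
    rw [norm_mul, norm_mul, norm_mul (g x * f x), norm_neg, ← mul_add]
    refine mul_le_mul_of_nonneg_left ?_ (norm_nonneg _)
    simp only [Real.norm_eq_abs, abs_exp]
    rcases le_total 0 (g x) with h0 | h0
    · exact (exp_le_exp.2 (by nlinarith)).trans (le_add_of_nonneg_left (exp_pos _).le)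
    · exact (exp_le_exp.2 (by nlinarith)).trans (le_add_of_nonneg_right (exp_pos _).le)
  · have h1 : HasDerivAt (fun t => -(V x + (t - a) * g x)) (-(1 * g x)) t :=
      ((((hasDerivAt_id t).sub_const a).mul_const (g x)).const_add (V x)).neg
    exact (h1.exp.const_mul (f x)).congr_deriv (by ring)

/-- Derivative of `∫ R_t w_t` for a family of polynomials `R_t` of bounded degree, when the
logarithmic derivative of the weight `w_t` at `t = a` is `-Q`. -/
lemma hasDerivAt_integral_eval_mul {w : ℝ → ℝ → ℝ} {a : ℝ} {Q : ℝ[X]}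
    (hint : ∀ᶠ t in nhds a, ∀ q : ℝ[X], Integrable fun x => q.eval x * w t x)
    (hmom : ∀ q : ℝ[X], HasDerivAt (fun t => ∫ x, q.eval x * w t x)
      (∫ x, (-(Q * q)).eval x * w a x) a)
    {R : ℝ → ℝ[X]} {R' : ℝ[X]} {N : ℕ} (hR : ∀ᶠ t in nhds a, (R t).natDegree < N)
    (hR' : R'.natDegree < N)
    (hcoeff : ∀ j, HasDerivAt (fun t => (R t).coeff j) (R'.coeff j) a) :
    HasDerivAt (fun t => ∫ x, (R t).eval x * w t x) (∫ x, (R' - Q * R a).eval x * w a x) a := by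
  have expand : ∀ t, (∀ q : ℝ[X], Integrable fun x => q.eval x * w t x) →
      ∀ S T : ℝ[X], S.natDegree < N → ∫ x, (T * S).eval x * w t x =
        ∑ j ∈ Finset.range N, S.coeff j * ∫ x, (T * X ^ j).eval x * w t x := by
    intro t ht S T hS
    simp_rw [← integral_const_mul]
    rw [← integral_finsetSum _ fun j _ => (ht _).const_mul _]
    refine integral_congr_ae (Filter.Eventually.of_forall fun x => ?_)
    simp only [eval_mul, eval_pow, eval_X]
    rw [eval_eq_sum_range' hS, Finset.mul_sum, Finset.sum_mul]
    exact Finset.sum_congr rfl fun j _ => by ring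
  have hinta := hint.self_of_nhds
  have hsum : HasDerivAt
      (fun t => ∑ j ∈ Finset.range N, (R t).coeff j * ∫ x, (X ^ j : ℝ[X]).eval x * w t x)
      (∑ j ∈ Finset.range N, (R'.coeff j * (∫ x, (X ^ j : ℝ[X]).eval x * w a x)
        + (R a).coeff j * ∫ x, (-(Q * X ^ j)).eval x * w a x)) a :=
    HasDerivAt.fun_sum fun j _ => (hcoeff j).mul (hmom (X ^ j))
  refine (hsum.congr_of_eventuallyEq ?_).congr_deriv ?_
  · filter_upwards [hint, hR] with t ht hRt
    simpa using expand t ht (R t) 1 hRt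
  · have e1 := expand a hinta R' 1 hR'
    have e2 := expand a hinta (R a) (-Q) hR.self_of_nhds
    simp only [one_mul] at e1
    simp only [neg_mul] at e2
    rw [Finset.sum_add_distrib, ← e1, ← e2, ← integral_add (hinta _) (hinta _)]
    refine integral_congr_ae (Filter.Eventually.of_forall fun x => ?_)
    simp only [eval_sub, eval_neg]
    ring

/-- Integration of polynomials against a weight, as a linear functional. -/
noncomputable def weightedIntegral (w : ℝ → ℝ)
    (hint : ∀ q : ℝ[X], Integrable fun x => q.eval x * w x) : ℝ[X] →ₗ[ℝ] ℝ where
  toFun q := ∫ x, q.eval x * w x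
  map_add' q r := by
    rw [← integral_add (hint q) (hint r)]
    simp only [eval_add, add_mul]
  map_smul' c q := by
    simp only [eval_smul, smul_eq_mul, RingHom.id_apply, mul_assoc]
    exact integral_const_mul _ _

/-- Orthogonal monic polynomials are orthogonal to all polynomials of lower degree. -/
lemma eq_zero_of_degree_lt_of_orthogonal {L : ℝ[X] →ₗ[ℝ] ℝ} {P : ℕ → ℝ[X]}
    (hmonic : ∀ n, (P n).Monic) (hdeg : ∀ n, (P n).natDegree = n)
    (horth : ∀ n m, n ≠ m → L (P n * P m) = 0) (n : ℕ) :
    ∀ d ≤ n, ∀ q : ℝ[X], q.degree < d → L (P n * q) = 0 := by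
  intro d
  induction d with
  | zero =>
    intro _ q hq
    have : q = 0 := by
      rw [← degree_eq_bot]
      simpa [Nat.WithBot.lt_zero_iff] using hq
    simp [this]
  | succ d ih =>
    intro hd q hq
    have hPd : (P d).degree = d := by
      rw [degree_eq_natDegree (hmonic d).ne_zero, hdeg d]
    have hlt : (q - C (q.coeff d) * P d).degree < d := by
      rw [degree_lt_iff_coeff_zero]
      intro k hk
      rcases hk.eq_or_lt with rfl | hk
      · have : (P d).coeff d = 1 := by simpa [hdeg d] using (hmonic d).coeff_natDegree
        simp [this]
      · have h1 : q.coeff k = 0 := (degree_lt_iff_coeff_zero q (d + 1)).1 hq k hk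
        have h2 : (P d).coeff k = 0 :=
          coeff_eq_zero_of_natDegree_lt (by rw [hdeg d]; exact hk)
        simp [h1, h2]
    have h0 := ih (by omega) _ hlt
    have : P n * q = P n * (q - C (q.coeff d) * P d) + q.coeff d • (P n * P d) := by
      rw [smul_eq_C_mul]; ring
    rw [this, map_add, h0, map_smul, horth n d (by omega), smul_zero, add_zero]

/-- Antisymmetrization: if `L (A P_m + P_n B) = L (Q P_n P_m)` with `A`, `B` of degree lower than
`n`, `m`, then `L ((A - Q P_n / 2) P_m)` is `± L (Q P_n P_m) / 2`. -/
lemma sub_half_eq_sign_mul {L : ℝ[X] →ₗ[ℝ] ℝ} {P : ℕ → ℝ[X]}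
    (hlow : ∀ n : ℕ, ∀ q : ℝ[X], q.degree < n → L (P n * q) = 0)
    {n m : ℕ} (hnm : n ≠ m) {A B Q : ℝ[X]} (hA : A.degree < n) (hB : B.degree < m)
    (hparts : L (A * P m) + L (P n * B) = L (Q * (P n * P m))) :
    L (A * P m) - 1 / 2 * L (Q * (P n * P m))
      = Real.sign ((n : ℝ) - m) / 2 * L (Q * (P n * P m)) := by
  rcases lt_or_gt_of_ne hnm with h | h
  · have hs : Real.sign ((n : ℝ) - m) = -1 :=
      Real.sign_of_neg (sub_neg.2 (by exact_mod_cast h))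
    have h0 : L (A * P m) = 0 := by
      rw [mul_comm]
      exact hlow m A (hA.trans (by exact_mod_cast h))
    rw [hs, h0]; ring
  · have hs : Real.sign ((n : ℝ) - m) = 1 :=
      Real.sign_of_pos (sub_pos.2 (by exact_mod_cast h))
    have h0 : L (P n * B) = 0 := hlow n B (hB.trans (by exact_mod_cast h))
    rw [hs]; linarith

/-- Coefficientwise differentiation of a product of polynomials. -/
lemma hasDerivAt_coeff_mul {R S : ℝ → ℝ[X]} {R' S' : ℝ[X]} {a : ℝ}
    (hR : ∀ j, HasDerivAt (fun t => (R t).coeff j) (R'.coeff j) a)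
    (hS : ∀ j, HasDerivAt (fun t => (S t).coeff j) (S'.coeff j) a) (j : ℕ) :
    HasDerivAt (fun t => (R t * S t).coeff j) ((R' * S a + R a * S').coeff j) a := by
  simp only [coeff_add, coeff_mul, ← Finset.sum_add_distrib]
  exact HasDerivAt.fun_sum fun i _ => (hR i.1).mul (hS i.2)

/-- Differentiation of the values of a family of polynomials of bounded degree. -/
lemma hasDerivAt_eval_of_coeff {R : ℝ → ℝ[X]} {R' : ℝ[X]} {a : ℝ} {N : ℕ}
    (hN : ∀ᶠ t in nhds a, (R t).natDegree < N) (hR' : R'.natDegree < N)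
    (hR : ∀ j, HasDerivAt (fun t => (R t).coeff j) (R'.coeff j) a) (x : ℝ) :
    HasDerivAt (fun t => (R t).eval x) (R'.eval x) a := by
  rw [eval_eq_sum_range' hR']
  refine HasDerivAt.congr_of_eventuallyEq
    (f := fun t => ∑ j ∈ Finset.range N, (R t).coeff j * x ^ j)
    (HasDerivAt.fun_sum fun j _ => (hR j).mul_const (x ^ j)) ?_
  filter_upwards [hN] with t ht
  exact eval_eq_sum_range' ht x

/-- A differentiable family of monic polynomials of degree `n` has a derivative of degree less
than `n`. -/
lemma exists_degree_lt_hasDerivAt_coeff {R : ℝ → ℝ[X]} {a : ℝ} {n : ℕ}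
    (hmonic : ∀ᶠ t in nhds a, (R t).Monic) (hdeg : ∀ᶠ t in nhds a, (R t).natDegree = n)
    (hdiff : ∀ j, DifferentiableAt ℝ (fun t => (R t).coeff j) a) :
    ∃ A : ℝ[X], A.degree < n ∧ ∀ j, HasDerivAt (fun t => (R t).coeff j) (A.coeff j) a := by
  refine ⟨∑ j ∈ Finset.range n, C (deriv (fun t => (R t).coeff j) a) * X ^ j, ?_, fun j => ?_⟩
  · rw [degree_lt_iff_coeff_zero]
    intro k hk
    simp only [finsetSum_coeff, coeff_C_mul_X_pow]
    exact Finset.sum_eq_zero fun j hj => if_neg (by have := Finset.mem_range.1 hj; omega)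
  · have hcoeff : (∑ i ∈ Finset.range n, C (deriv (fun t => (R t).coeff i) a) * X ^ i).coeff j
        = if j < n then deriv (fun t => (R t).coeff j) a else 0 := by
      simp
    rw [hcoeff]
    split_ifs with hj
    · exact (hdiff j).hasDerivAt
    · refine (hasDerivAt_const a (if j = n then (1 : ℝ) else 0)).congr_of_eventuallyEq ?_
      filter_upwards [hmonic, hdeg] with t h1 h2
      split_ifs with hjn
      · rw [hjn, ← h2]; exact h1.coeff_natDegree
      · exact coeff_eq_zero_of_natDegree_lt (by omega)

theorem stmt18
    (D : ℕ) (hDeven : Even D) (hD2 : 2 ≤ D)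
    (U : Set (Fin D → ℝ)) (hUopen : IsOpen U)
    (hUpos : ∀ u ∈ U, 0 < u ⟨D - 1, by omega⟩)
    (Vf : (Fin D → ℝ) → ℝ → ℝ)
    (hVf : ∀ (u : Fin D → ℝ) (x : ℝ),
      Vf u x = ∑ i : Fin D, u i / ((i : ℕ) + 1) * x ^ ((i : ℕ) + 1))
    (hint : ∀ u ∈ U, ∀ q : Polynomial ℝ,
      Integrable (fun x : ℝ => q.eval x * Real.exp (-(Vf u x))))
    (p : (Fin D → ℝ) → ℕ → Polynomial ℝ)
    (hmonic : ∀ u ∈ U, ∀ n, (p u n).Monic)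
    (hpdeg : ∀ u ∈ U, ∀ n, (p u n).natDegree = n)
    (horth : ∀ u ∈ U, ∀ n m, n ≠ m →
      ∫ x : ℝ, (p u n).eval x * (p u m).eval x * Real.exp (-(Vf u x)) = 0)
    (h : (Fin D → ℝ) → ℕ → ℝ)
    (hh : ∀ (u : Fin D → ℝ) (n : ℕ),
      h u n = ∫ x : ℝ, ((p u n).eval x) ^ 2 * Real.exp (-(Vf u x)))
    (hhpos : ∀ u ∈ U, ∀ n, 0 < h u n)
    (ψ : (Fin D → ℝ) → ℕ → ℝ → ℝ)
    (hψ : ∀ (u : Fin D → ℝ) (n : ℕ) (x : ℝ),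
      ψ u n x = (p u n).eval x * Real.exp (-(Vf u x) / 2) / Real.sqrt (h u n))
    (hcoeff : ∀ n j, DifferentiableOn ℝ (fun u => (p u n).coeff j) U)
    (u : Fin D → ℝ) (hu : u ∈ U) (n m : ℕ) :
    ∫ x : ℝ, deriv (ψ u n) x * ψ u m x
      = ∑ j : Fin (D - 1),
          ((j : ℕ) + 1 : ℝ) * u ⟨(j : ℕ) + 1, by have := j.isLt; omega⟩
            * ∫ x : ℝ,
                deriv (fun t => ψ (Function.update u ⟨(j : ℕ), by have := j.isLt; omega⟩ t) n x)
                    (u ⟨(j : ℕ), by have := j.isLt; omega⟩)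
                  * ψ u m x := by
  have hlin : ∀ (k : Fin D) (t x : ℝ), Vf (Function.update u k t) x
      = Vf u x + (t - u k) * (x ^ ((k : ℕ) + 1) / ((k : ℕ) + 1)) := by
    intro k t x
    have hterm : ∀ i : Fin D, Function.update u k t i / ((i : ℕ) + 1) * x ^ ((i : ℕ) + 1)
        = u i / ((i : ℕ) + 1) * x ^ ((i : ℕ) + 1)
          + if i = k then (t - u k) * (x ^ ((k : ℕ) + 1) / ((k : ℕ) + 1)) else 0 := by
      intro i
      by_cases hik : i = k
      · subst hik
        simp only [Function.update_self, if_true]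
        ring
      · simp [hik]
    rw [hVf, hVf, Finset.sum_congr rfl fun i _ => hterm i, Finset.sum_add_distrib]
    simp
  have hVcont : Continuous (Vf u) := by
    rw [funext (hVf u)]
    fun_prop
  set w : ℝ → ℝ := fun x => Real.exp (-(Vf u x)) with hw
  set L := weightedIntegral w (hint u hu)
  have hL : ∀ q : ℝ[X], L q = ∫ x, q.eval x * w x := fun _ => rfl
  have hLorth : ∀ n m, n ≠ m → L (p u n * p u m) = 0 := by
    intro n m hnm
    rw [hL, ← horth u hu n m hnm]
    simp only [eval_mul, hw]
  have hLh : ∀ n, h u n = L (p u n * p u n) := by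
    intro n
    rw [hL, hh]
    simp only [eval_mul, hw, sq]
  have hlow : ∀ n : ℕ, ∀ q : ℝ[X], q.degree < n → L (p u n * q) = 0 := fun n =>
    eq_zero_of_degree_lt_of_orthogonal (hmonic u hu) (hpdeg u hu) hLorth n n le_rfl
  set V' : ℝ[X] := ∑ i : Fin D, C (u i) * X ^ (i : ℕ) with hV'
  have hVderiv : ∀ x, HasDerivAt (Vf u) (V'.eval x) x := by
    intro x
    rw [funext (hVf u), hV', eval_finsetSum]
    refine HasDerivAt.fun_sum fun i _ => ?_
    refine ((hasDerivAt_pow ((i : ℕ) + 1) x).const_mul (u i / ((i : ℕ) + 1))).congr_deriv ?_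
    have : ((i : ℕ) : ℝ) + 1 ≠ 0 := by positivity
    simp only [eval_mul, eval_C, eval_pow, eval_X, Nat.add_sub_cancel]
    push_cast
    field_simp
  have hparts : ∀ q : ℝ[X], L (derivative q) = L (V' * q) := by
    intro q
    rw [← sub_eq_zero, ← map_sub, hL]
    refine integral_eq_zero_of_hasDerivAt_of_integrable (fun x => ?_) (hint u hu _) (hint u hu q)
    refine ((q.hasDerivAt x).mul (hVderiv x).neg.exp).congr_deriv ?_
    simp only [eval_sub, eval_mul, hw, Pi.neg_apply]
    ring
  have hform : ∀ (F : ℝ → ℝ) (q : ℝ[X]),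
      (∀ x, F x = q.eval x * Real.exp (-(Vf u x) / 2) / √(h u n)) →
      ∫ x, F x * ψ u m x = (√(h u n) * √(h u m))⁻¹ * L (q * p u m) := by
    intro F q hF
    rw [hL, ← integral_const_mul]
    refine integral_congr_ae (Filter.Eventually.of_forall fun x => ?_)
    have he : w x = Real.exp (-(Vf u x) / 2) * Real.exp (-(Vf u x) / 2) := by
      rw [← Real.exp_add, hw]
      ring_nf
    simp only [hF, hψ, eval_mul, he]
    ring
  have hlt : ∀ n, (derivative (p u n)).degree < n := fun n => by
    have := degree_derivative_lt (hmonic u hu n).ne_zero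
    rwa [degree_eq_natDegree (hmonic u hu n).ne_zero, hpdeg u hu n] at this
  have hx : ∫ x, deriv (ψ u n) x * ψ u m x = (√(h u n) * √(h u m))⁻¹ *
      (Real.sign ((n : ℝ) - m) / 2 * L (V' * (p u n * p u m))) := by
    rw [hform _ (derivative (p u n) - (1 / 2 : ℝ) • (V' * p u n))]
    · congr 1
      rw [sub_mul, smul_mul_assoc, map_sub, map_smul, smul_eq_mul, mul_assoc V']
      have hp := hparts (p u n * p u m)
      rw [derivative_mul, map_add] at hp
      rcases eq_or_ne n m with rfl | hnm
      · have h0 : L (derivative (p u n) * p u n) = 0 := by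
          rw [mul_comm]
          exact hlow n _ (hlt n)
        rw [mul_comm (p u n) (derivative _), h0] at hp
        simp [h0, ← hp]
      · exact sub_half_eq_sign_mul hlow hnm (hlt n) (hlt m) hp
    · intro x
      refine HasDerivAt.deriv ?_
      rw [funext (hψ u n)]
      refine ((((p u n).hasDerivAt x).mul
        ((hVderiv x).neg.div_const 2).exp).div_const √(h u n)).congr_deriv ?_
      simp only [eval_sub, eval_smul, eval_mul, smul_eq_mul, Pi.neg_apply]
      ring
  have hk : ∀ k : Fin D,
      ∫ x, deriv (fun t => ψ (Function.update u k t) n x) (u k) * ψ u m x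
        = (√(h u n) * √(h u m))⁻¹ * (Real.sign ((n : ℝ) - m) / 2 *
          (((k : ℕ) + 1 : ℝ)⁻¹ * L (X ^ ((k : ℕ) + 1) * (p u n * p u m)))) := by
    intro k
    set g : ℝ → (Fin D → ℝ) := Function.update u k with hg
    have hga : g (u k) = u := Function.update_eq_self k u
    have hgd : Differentiable ℝ g := fun t => (hasDerivAt_update u k t).differentiableAt
    have hgU : ∀ᶠ t in nhds (u k), g t ∈ U :=
      hgd.continuous.continuousAt.eventually_mem (by rw [hga]; exact hUopen.mem_nhds hu)
    have hA : ∀ n : ℕ, ∃ A : ℝ[X], A.degree < n ∧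
        ∀ j, HasDerivAt (fun t => (p (g t) n).coeff j) (A.coeff j) (u k) := by
      intro n
      refine exists_degree_lt_hasDerivAt_coeff (hgU.mono fun t ht => hmonic _ ht n)
        (hgU.mono fun t ht => hpdeg _ ht n) fun j => ?_
      have hd : DifferentiableAt ℝ (fun v => (p v n).coeff j) (g (u k)) := by
        rw [hga]
        exact (hcoeff n j).differentiableAt (hUopen.mem_nhds hu)
      exact hd.comp (u k) (hgd _)
    choose A hAdeg hAcoeff using hA
    have hAnat : ∀ n : ℕ, (A n).natDegree ≤ n := fun n =>
      natDegree_le_of_degree_le (hAdeg n).le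
    set Q : ℝ[X] := C (((k : ℕ) + 1 : ℝ)⁻¹) * X ^ ((k : ℕ) + 1) with hQ
    have hQx : ∀ x, Q.eval x = x ^ ((k : ℕ) + 1) / ((k : ℕ) + 1) := by
      intro x
      simp only [hQ, eval_mul, eval_C, eval_pow, eval_X]
      ring
    have hgV : ∀ t x, Vf (g t) x = Vf u x + (t - u k) * Q.eval x := by
      intro t x
      rw [hQx]
      exact hlin k t x
    have hmom : ∀ q : ℝ[X], HasDerivAt (fun t => ∫ x, q.eval x * Real.exp (-(Vf (g t) x)))
        (∫ x, (-(Q * q)).eval x * Real.exp (-(Vf (g (u k)) x))) (u k) := by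
      intro q
      obtain ⟨ε, hε, hball⟩ := Metric.eventually_nhds_iff.1 hgU
      have hside : ∀ δ : ℝ, |δ| < ε →
          Integrable fun x => Q.eval x * q.eval x * Real.exp (-(Vf u x + δ * Q.eval x)) := by
        intro δ hδ
        have := hint (g (u k + δ)) (hball (by simpa [Real.dist_eq] using hδ)) (Q * q)
        simpa only [eval_mul, hgV, add_sub_cancel_left] using this
      have := hasDerivAt_integral_mul_exp_neg_add (V := Vf u) (g := fun x => Q.eval x)
        (f := fun x => q.eval x) (a := u k) (ε := ε / 2) (by positivity) hVcont
        Q.continuous q.continuous (hint u hu q)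
        (hside _ (by rw [abs_of_pos (by positivity)]; linarith))
        (hside _ (by rw [abs_neg, abs_of_pos (by positivity)]; linarith))
      simpa only [hgV, hga, sub_self, zero_mul, add_zero, eval_neg, eval_mul] using this
    have hE : ∀ n m, HasDerivAt
        (fun t => ∫ x, (p (g t) n * p (g t) m).eval x * Real.exp (-(Vf (g t) x)))
        (L (A n * p u m) + L (p u n * A m) - L (Q * (p u n * p u m))) (u k) := by
      intro n m
      have hpm : ∀ n, (p u n).natDegree ≤ n := fun n => (hpdeg u hu n).le
      have := hasDerivAt_integral_eval_mul (w := fun t x => Real.exp (-(Vf (g t) x)))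
        (hgU.mono fun t ht => hint _ ht) hmom (R := fun t => p (g t) n * p (g t) m)
        (R' := A n * p (g (u k)) m + p (g (u k)) n * A m) (N := n + m + 1)
        (hgU.mono fun t ht => Nat.lt_succ_of_le (natDegree_mul_le_of_le
          (hpdeg _ ht n).le (hpdeg _ ht m).le))
        (Nat.lt_succ_of_le (natDegree_add_le_of_degree_le
          (natDegree_mul_le_of_le (hAnat n) (by rw [hga]; exact hpm m))
          (natDegree_mul_le_of_le (by rw [hga]; exact hpm n) (hAnat m))))
        (hasDerivAt_coeff_mul (hAcoeff n) (hAcoeff m))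
      refine this.congr_deriv ?_
      rw [hga, ← map_add, ← map_sub, hL]
    have hhd : HasDerivAt (fun t => h (g t) n) (-L (Q * (p u n * p u n))) (u k) := by
      have h0 : L (p u n * A n) = 0 := hlow n _ (hAdeg n)
      have := hE n n
      rw [mul_comm (A n), h0] at this
      refine (this.congr_deriv (by ring)).congr_of_eventuallyEq
        (Filter.Eventually.of_forall fun t => ?_)
      simp only [hh, eval_mul, sq]
    have hQL : ((k : ℕ) + 1 : ℝ)⁻¹ * L (X ^ ((k : ℕ) + 1) * (p u n * p u m))
        = L (Q * (p u n * p u m)) := by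
      rw [hQ, mul_assoc, ← smul_eq_C_mul, map_smul, smul_eq_mul]
    rw [hQL, hform _ (A n - (1 / 2 : ℝ) • (Q * p u n)
      + (L (Q * (p u n * p u n)) / (2 * h u n)) • p u n)]
    · congr 1
      rw [add_mul, sub_mul, smul_mul_assoc, smul_mul_assoc, map_add, map_sub, map_smul, map_smul,
        smul_eq_mul, smul_eq_mul, mul_assoc Q]
      rcases eq_or_ne n m with rfl | hnm
      · have h0 : L (A n * p u n) = 0 := by
          rw [mul_comm]
          exact hlow n _ (hAdeg n)
        have := (hhpos u hu n).ne'
        rw [h0, ← hLh]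
        simp only [sub_self, Real.sign_zero]
        field_simp
        ring
      · rw [hLorth n m hnm, mul_zero, add_zero]
        refine sub_half_eq_sign_mul hlow hnm (hAdeg n) (hAdeg m) ?_
        refine sub_eq_zero.1 ((hE n m).unique ?_)
        refine (hasDerivAt_const (u k) (0 : ℝ)).congr_of_eventuallyEq (hgU.mono fun t ht => ?_)
        simpa only [eval_mul] using horth _ ht n m hnm
    · intro x
      refine HasDerivAt.deriv ?_
      have hpx : HasDerivAt (fun t => (p (g t) n).eval x) ((A n).eval x) (u k) :=
        hasDerivAt_eval_of_coeff (N := n + 1)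
          (hgU.mono fun t ht => Nat.lt_succ_of_le (hpdeg _ ht n).le)
          (Nat.lt_succ_of_le (hAnat n)) (hAcoeff n) x
      have hVx : HasDerivAt (fun t => Vf (g t) x) (Q.eval x) (u k) := by
        simp only [hgV]
        simpa using
          (((hasDerivAt_id (u k)).sub_const (u k)).mul_const (Q.eval x)).const_add (Vf u x)
      have hpos : 0 < h u n := hhpos u hu n
      have hsq : HasDerivAt (fun t => √(h (g t) n))
          (-L (Q * (p u n * p u n)) / (2 * √(h u n))) (u k) := by
        have := hhd.sqrt (by rw [hga]; exact hpos.ne')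
        rwa [hga] at this
      have hsqpos : 0 < √(h u n) := Real.sqrt_pos.2 hpos
      have hsqsq : √(h u n) ^ 2 = h u n := Real.sq_sqrt hpos.le
      simp only [hψ]
      refine ((hpx.mul (hVx.neg.div_const 2).exp).div hsq
        (by rw [hga]; exact hsqpos.ne')).congr_deriv ?_
      simp only [eval_add, eval_sub, eval_smul, eval_mul, smul_eq_mul, Pi.neg_apply, Pi.mul_apply,
        hga]
      generalize L (Q * (p u n * p u n)) = l
      rw [← hsqsq, Real.sqrt_sq hsqpos.le]
      field_simp
      ring
  rw [hx]
  simp_rw [hk]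
  obtain ⟨d, rfl⟩ : ∃ d, D = d + 1 := ⟨D - 1, by omega⟩
  have hVL : Real.sign ((n : ℝ) - m) / 2 * L (V' * (p u n * p u m))
      = ∑ j : Fin d, Real.sign ((n : ℝ) - m) / 2 *
        (u j.succ * L (X ^ ((j : ℕ) + 1) * (p u n * p u m))) := by
    have h0 : Real.sign ((n : ℝ) - m) * L (p u n * p u m) = 0 := by
      rcases eq_or_ne n m with rfl | hnm
      · simp
      · rw [hLorth n m hnm, mul_zero]
    have hterm : ∀ i : Fin (d + 1), L (C (u i) * X ^ (i : ℕ) * (p u n * p u m))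
        = u i * L (X ^ (i : ℕ) * (p u n * p u m)) := fun i => by
      rw [mul_assoc, ← smul_eq_C_mul, map_smul, smul_eq_mul]
    rw [hV', Finset.sum_mul, map_sum, ← Finset.mul_sum]
    simp only [hterm]
    rw [Fin.sum_univ_succ]
    simp only [Fin.val_zero, pow_zero, one_mul, Fin.val_succ]
    linear_combination u 0 / 2 * h0
  rw [hVL, Finset.mul_sum]
  refine Finset.sum_congr rfl fun j _ => ?_
  have hj : ((j : ℕ) : ℝ) + 1 ≠ 0 := by positivity
  have hs : u j.succ = u ⟨(j : ℕ) + 1, by have := j.isLt; omega⟩ := rfl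
  rw [hs]
  field_simp
end
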